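/- Fix b > 0 and x̂ ∈ ℝ. Suppose h : ℝ → ℝ is a continuous function satisfying, for all real numbers a₁ ≤ a₂, the identity ∫_{x̂}^{∞} L(x; a₁, b) dx + ∫_{a₁}^{a₂} h(a) da + ∫_{−∞}^{x̂} L(x; a₂, b) dx = 1. Then h coincides everywhere with the confidence density: h(a) = L̃(a; x̂, b) for all a ∈ ℝ. That is, the confidence density of the Laplace location parameter is uniquely determined among continuous functions. -/

import Mathlib

open MeasureTheory

/-- The Laplace probability density `L(x; a, b) = (1/(2b)) * exp (-|x - a| / b)`. -/
noncomputable def laplaceDensity (x a b : ℝ) : ℝ :=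
  (1 / (2 * b)) * Real.exp (-|x - a| / b)

/-- The confidence density of the location parameter `a` given observation `x̂`. -/
noncomputable def laplaceConfidenceDensity (a xhat b : ℝ) : ℝ :=
  (1 / (2 * b)) * Real.exp (-|xhat - a| / b)

/-- Among continuous functions, the confidence density of the Laplace location
parameter is uniquely determined by the interval identity. -/
theorem laplace_confidence_density_unique_of_continuous
    (b : ℝ) (hb : 0 < b) (xhat : ℝ) (h : ℝ → ℝ) (hc : Continuous h)
    (hid : ∀ a₁ a₂ : ℝ, a₁ ≤ a₂ →
      (∫ x in Set.Ioi xhat, laplaceDensity x a₁ b) +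
        (∫ a in a₁..a₂, h a) +
          (∫ x in Set.Iic xhat, laplaceDensity x a₂ b) = 1) :
    ∀ a : ℝ, h a = laplaceConfidenceDensity a xhat b := by
  set f : ℝ → ℝ := fun u => (1 / (2 * b)) * Real.exp (-|u| / b) with hf
  have hfc : Continuous f := by
    rw [hf]; fun_prop
  have hint : ∀ c : ℝ, IntegrableOn f (Set.Iic c) := by
    intro c
    have h1 : IntegrableOn (fun u : ℝ => (1 / (2 * b)) * Real.exp (b⁻¹ * u)) (Set.Iic c) :=
      (integrableOn_exp_mul_Iic (inv_pos.mpr hb) c).const_mul _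
    refine Integrable.mono' h1 hfc.aestronglyMeasurable ?_
    refine Filter.Eventually.of_forall fun u => ?_
    rw [Real.norm_of_nonneg (by rw [hf]; positivity)]
    simp only [hf]
    have : -|u| / b ≤ b⁻¹ * u := by
      rw [div_eq_inv_mul]
      exact mul_le_mul_of_nonneg_left (neg_abs_le u) (inv_pos.mpr hb).le
    gcongr
  have hG : ∀ t : ℝ, (∫ x in Set.Iic xhat, laplaceDensity x t b) =
      ∫ u in Set.Iic (xhat - t), f u := by
    intro t
    have := (measurePreserving_sub_right (volume : Measure ℝ) t).setIntegral_preimage_emb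
      (MeasurableEquiv.subRight t).measurableEmbedding f (Set.Iic (xhat - t))
    rw [← this]
    have hs : (fun x : ℝ => x - t) ⁻¹' Set.Iic (xhat - t) = Set.Iic xhat := by
      ext x; simp
    rw [hs]
    rfl
  intro a
  have hG2 : ∀ t : ℝ, (∫ x in Set.Iic xhat, laplaceDensity x t b) =
      (∫ u in Set.Iic (0:ℝ), f u) + ∫ u in (0:ℝ)..(xhat - t), f u := by
    intro t
    rw [hG, ← intervalIntegral.integral_Iic_sub_Iic (hint _) (hint _)]
    ring
  have hd1 : HasDerivAt (fun t => ∫ u in (0:ℝ)..(xhat - t), f u) (-f (xhat - a)) a := by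
    have h1 : HasDerivAt (fun s => ∫ u in (0:ℝ)..s, f u) (f (xhat - a)) (xhat - a) :=
      hfc.integral_hasStrictDerivAt 0 (xhat - a) |>.hasDerivAt
    have h2 : HasDerivAt (fun t : ℝ => xhat - t) (-1) a := by
      simpa using (hasDerivAt_id a).const_sub xhat
    simpa [Function.comp_def] using h1.comp a h2
  have hd2 : HasDerivAt (fun t => ∫ u in (a - 1)..t, h u) (h a) a :=
    (hc.integral_hasStrictDerivAt (a - 1) a).hasDerivAt
  have hd3 := hd2.add hd1
  have hd4 : HasDerivAt ((fun t => ∫ u in (a - 1)..t, h u) +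
      (fun t => ∫ u in (0:ℝ)..(xhat - t), f u)) 0 a := by
    refine (hasDerivAt_const a (1 - (∫ x in Set.Ioi xhat, laplaceDensity x (a - 1) b) -
      ∫ u in Set.Iic (0:ℝ), f u)).congr_of_eventuallyEq ?_
    filter_upwards [lt_mem_nhds (show a - 1 < a by linarith)] with t ht
    have := hid (a - 1) t ht.le
    rw [hG2] at this
    simp only [Pi.add_apply]
    linarith
  have := hd3.unique hd4
  change h a = f (xhat - a)
  linarith
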